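/- arXiv:1911.10733 — 2 statements merged into one kernel-verified Lean document; each statement's English description precedes it below -/
import Mathlib

section
/- Let A₁, …, Aₙ be positive invertible operators on H with mI ≤ Aⱼ ≤ MI (j = 1, …, n) for some scalars 0 < m < M, let Φ : B(H) → B(K) be a unital positive linear map, let h = M/m, and let F (on H) and G (on K) each satisfy the arithmetic–harmonic sandwich for the probability vector ω. Then for every r ≥ 1, G(Φ(A₁ʳ), …, Φ(Aₙʳ)) − Φ(F(A₁, …, Aₙ)ʳ) ≤ γ(1/M, 1/m, −r, K(h, r)⁻¹)·I. -/
noncomputable section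

/-- The arithmetic–harmonic sandwich for the probability vector `ω`:
`(∑ ωⱼ Bⱼ⁻¹)⁻¹ ≤ F (B₁, …, Bₙ) ≤ ∑ ωⱼ Bⱼ` for all positive invertible `B₁, …, Bₙ`,
and `F` takes values in the positive invertible operators. -/
def IsAHSandwich {E : Type*} [NormedAddCommGroup E] [InnerProductSpace ℂ E]
    [CompleteSpace E] {n : ℕ} (ω : Fin n → ℝ)
    (F : (Fin n → (E →L[ℂ] E)) → (E →L[ℂ] E)) : Prop :=
  ∀ B : Fin n → (E →L[ℂ] E), (∀ j, 0 ≤ B j) → (∀ j, IsUnit (B j)) →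
    (0 ≤ F B ∧ IsUnit (F B)) ∧
    Ring.inverse (∑ j, ω j • Ring.inverse (B j)) ≤ F B ∧
    F B ≤ ∑ j, ω j • B j

/-- The generalized Kantorovich constant `K(h, p)`, with `K(h, 0) = K(h, 1) = 1`. -/
def Kconst (h p : ℝ) : ℝ :=
  if p = 0 ∨ p = 1 then 1
  else ((h ^ p - h) / ((p - 1) * (h - 1))) *
    (((p - 1) / p) * ((h ^ p - 1) / (h ^ p - h))) ^ p

/-- The constant `γ(m, M, r, α)`, where real powers are `Real.rpow`. -/
def gammaConst (m M r α : ℝ) : ℝ :=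
  if m ≤ ((M ^ r - m ^ r) / (α * r * (M - m))) ^ (1 / (r - 1)) ∧
      ((M ^ r - m ^ r) / (α * r * (M - m))) ^ (1 / (r - 1)) ≤ M then
    α * (r - 1) * ((M ^ r - m ^ r) / (α * r * (M - m))) ^ (r / (r - 1)) +
      (M * m ^ r - m * M ^ r) / (M - m)
  else if M ≤ ((M ^ r - m ^ r) / (α * r * (M - m))) ^ (1 / (r - 1)) then
    (1 - α) * M ^ r
  else (1 - α) * m ^ r

section ScalarInequalities

/-- The graph of `t ↦ t ^ p` lies above its tangents when `p ∉ (0, 1)`. -/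
theorem rpow_tangent_le {p : ℝ} (hp : p ≤ 0 ∨ 1 ≤ p) {u t : ℝ} (hu : 0 < u) (ht : 0 < t) :
    u ^ p + p * u ^ (p - 1) * (t - u) ≤ t ^ p := by
  have bernoulli : ∀ x : ℝ, 0 < x → 1 + p * (x - 1) ≤ x ^ p := by
    intro x hx
    rcases hp with hp | hp
    · have h1 := Real.log_le_sub_one_of_pos hx
      have h2 := Real.add_one_le_exp (Real.log x * p)
      rw [Real.rpow_def_of_pos hx]
      nlinarith
    · simpa using one_add_mul_self_le_rpow_one_add (s := x - 1) (by linarith) hp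
  have h := mul_le_mul_of_nonneg_left (bernoulli (t / u) (by positivity))
    (Real.rpow_nonneg hu.le p)
  rw [← Real.mul_rpow hu.le (by positivity), mul_div_cancel₀ _ hu.ne'] at h
  refine le_of_eq_of_le ?_ h
  rw [Real.rpow_sub_one hu.ne']
  field_simp

/-- The graph of `t ↦ t ^ p` lies below its chords when `p ∉ (0, 1)`. -/
theorem rpow_le_chord {p : ℝ} (hp : p ≤ 0 ∨ 1 ≤ p) {m M t : ℝ} (hm : 0 < m) (hmM : m < M)
    (hmt : m ≤ t) (htM : t ≤ M) :
    t ^ p ≤ m ^ p + (M ^ p - m ^ p) / (M - m) * (t - m) := by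
  have ht : 0 < t := hm.trans_le hmt
  have h1 := mul_le_mul_of_nonneg_left (rpow_tangent_le hp ht hm) (sub_nonneg.2 htM)
  have h2 := mul_le_mul_of_nonneg_left (rpow_tangent_le hp ht (hm.trans hmM)) (sub_nonneg.2 hmt)
  have hd : 0 < M - m := sub_pos.2 hmM
  rw [div_mul_eq_mul_div, ← sub_le_iff_le_add', le_div_iff₀ hd]
  linarith

theorem lt_rpow_of_one_lt {h r : ℝ} (hh : 1 < h) (hr : 1 < r) : h < h ^ r := by
  simpa using Real.rpow_lt_rpow_of_exponent_lt hh hr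

theorem Kconst_pos {h r : ℝ} (hh : 1 < h) (hr : 1 ≤ r) : 0 < Kconst h r := by
  unfold Kconst
  split_ifs with h0
  · exact one_pos
  · push Not at h0
    have hr' : 1 < r := lt_of_le_of_ne hr (Ne.symm h0.2)
    have h1 := sub_pos.2 (lt_rpow_of_one_lt hh hr')
    have h2 : 0 < h ^ r - 1 := by linarith
    have h3 : 0 < r - 1 := by linarith
    have h4 : 0 < h - 1 := by linarith
    positivity

theorem chord_le_Kconst_mul_rpow_of_one_lt {h r s : ℝ} (hh : 1 < h) (hr : 1 ≤ r) (hs : 0 < s) :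
    1 + (h ^ r - 1) / (h - 1) * (s - 1) ≤ Kconst h r * s ^ r := by
  have h4 : 0 < h - 1 := by linarith
  unfold Kconst
  split_ifs with h0
  · obtain rfl : r = 1 := by
      rcases h0 with h0 | h0
      · linarith
      · exact h0
    simp [h4.ne']
  · push Not at h0
    have hr' : 1 < r := lt_of_le_of_ne hr (Ne.symm h0.2)
    have h1 := sub_pos.2 (lt_rpow_of_one_lt hh hr')
    have h2 : 0 < h ^ r - 1 := by linarith
    have h3 : 0 < r - 1 := by linarith
    set c := (h ^ r - h) / ((r - 1) * (h - 1)) with hc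
    set w := (r - 1) / r * ((h ^ r - 1) / (h ^ r - h)) with hw
    have hc0 : 0 < c := by positivity
    have hw0 : 0 < w := by positivity
    rw [mul_assoc, ← Real.mul_rpow hw0.le hs.le]
    have hB := rpow_tangent_le (Or.inr hr) one_pos (mul_pos hw0 hs)
    simp only [Real.one_rpow, mul_one] at hB
    refine le_of_eq_of_le ?_ (mul_le_mul_of_nonneg_left hB hc0.le)
    rw [hc, hw]
    field_simp
    ring

/-- The chord of `t ↦ t ^ r` over `[m, M]` is dominated by `K(M / m, r) t ^ r`. -/
theorem chord_le_Kconst_mul_rpow {m M r t : ℝ} (hm : 0 < m) (hmM : m < M) (hr : 1 ≤ r)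
    (ht : 0 < t) :
    m ^ r + (M ^ r - m ^ r) / (M - m) * (t - m) ≤ Kconst (M / m) r * t ^ r := by
  have hh : 1 < M / m := (one_lt_div hm).2 hmM
  have h := mul_le_mul_of_nonneg_left
    (chord_le_Kconst_mul_rpow_of_one_lt hh hr (div_pos ht hm)) (Real.rpow_nonneg hm.le r)
  have hmr := Real.rpow_pos_of_pos hm r
  have hd : M - m ≠ 0 := (sub_pos.2 hmM).ne'
  rw [Real.div_rpow ht.le hm.le, Real.div_rpow (hm.trans hmM).le hm.le] at h
  have e1 : m ^ r * (Kconst (M / m) r * (t ^ r / m ^ r)) = Kconst (M / m) r * t ^ r := by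
    field_simp
  have e2 : m ^ r * (1 + (M ^ r / m ^ r - 1) / (M / m - 1) * (t / m - 1)) =
      m ^ r + (M ^ r - m ^ r) / (M - m) * (t - m) := by
    rw [div_sub_one hm.ne', div_sub_one hm.ne', div_sub_one hmr.ne']
    field_simp
  rwa [e1, e2] at h

/-- The gap between the chord of `t ↦ t ^ p` over `[m, M]` and `α t ^ p` is at most
`γ(m, M, p, α)`. -/
theorem chord_le_mul_rpow_add_gammaConst {m M p α t : ℝ} (hm : 0 < m) (hmM : m < M) (hp : p < 0)
    (hα : 0 < α) (hmt : m ≤ t) (htM : t ≤ M) :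
    m ^ p + (M ^ p - m ^ p) / (M - m) * (t - m) ≤ α * t ^ p + gammaConst m M p α := by
  have hM : 0 < M := hm.trans hmM
  have ht : 0 < t := hm.trans_le hmt
  have hd : 0 < M - m := sub_pos.2 hmM
  have hαp : α * p < 0 := mul_neg_of_pos_of_neg hα hp
  set a := (M ^ p - m ^ p) / (M - m) with ha
  have ha_neg : a < 0 := div_neg_of_neg_of_pos
    (sub_neg.2 (Real.rpow_lt_rpow_of_neg hm hmM hp)) hd
  have hbase : (M ^ p - m ^ p) / (α * p * (M - m)) = a / (α * p) := by
    rw [ha, div_div, mul_comm (M - m)]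
  have hq : 0 < a / (α * p) := div_pos_of_neg_of_neg ha_neg hαp
  have hp1 : p - 1 ≠ 0 := by linarith
  unfold gammaConst
  rw [hbase]
  set u := (a / (α * p)) ^ (1 / (p - 1)) with hu_def
  have hu : 0 < u := Real.rpow_pos_of_pos hq _
  have hu1 : α * p * u ^ (p - 1) = a := by
    rw [hu_def, ← Real.rpow_mul hq.le, one_div_mul_cancel hp1, Real.rpow_one,
      mul_div_cancel₀ _ hαp.ne]
  have hup : (a / (α * p)) ^ (p / (p - 1)) = u ^ p := by
    rw [hu_def, ← Real.rpow_mul hq.le, div_mul_eq_mul_div, one_mul]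
  have hcu : α * p * u ^ p = a * u := by
    rw [← hu1, Real.rpow_sub_one hu.ne']
    field_simp
  have tangent : ∀ v : ℝ, 0 < v → α * v ^ p + α * p * v ^ (p - 1) * (t - v) ≤ α * t ^ p := by
    intro v hv
    have := mul_le_mul_of_nonneg_left (rpow_tangent_le (Or.inl hp.le) hv ht) hα.le
    linarith
  have slope : ∀ {v w : ℝ}, 0 < v → v ≤ w → α * p * v ^ (p - 1) ≤ α * p * w ^ (p - 1) := by
    intro v w hv hvw
    exact mul_le_mul_of_nonpos_left
      (Real.rpow_le_rpow_of_nonpos hv hvw (by linarith)) hαp.le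
  have hchord : M ^ p = m ^ p + a * (M - m) := by
    rw [ha, div_mul_cancel₀ _ hd.ne']
    ring
  split_ifs with h1 h2
  · have hint : (M * m ^ p - m * M ^ p) / (M - m) = m ^ p - a * m := by
      rw [hchord]
      field_simp
      ring
    have h := tangent u hu
    rw [hu1] at h
    rw [hup, hint]
    nlinarith
  · have h := tangent M hM
    have hs := slope hM h2
    rw [hu1] at hs
    nlinarith [mul_nonneg (sub_nonneg.2 hs) (sub_nonneg.2 htM)]
  · have hum : u ≤ m := by
      by_contra! hlt
      exact h1 ⟨hlt.le, (not_le.1 h2).le⟩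
    have h := tangent m hm
    have hs := slope hu hum
    rw [hu1] at hs
    nlinarith [mul_nonneg (sub_nonneg.2 hs) (sub_nonneg.2 hmt)]

end ScalarInequalities

section OperatorInequalities

variable {E : Type*} [NormedAddCommGroup E] [InnerProductSpace ℂ E] [CompleteSpace E]

theorem spectrum_subset_Icc_of_smul_one_le {T : E →L[ℂ] E} {m M : ℝ} (hm : 0 < m)
    (h1 : m • (1 : E →L[ℂ] E) ≤ T) (h2 : T ≤ M • (1 : E →L[ℂ] E)) :
    0 ≤ T ∧ IsUnit T ∧ spectrum ℝ T ⊆ Set.Icc m M := by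
  have h0 : 0 ≤ T := (smul_nonneg hm.le zero_le_one).trans h1
  have hs : spectrum ℝ T ⊆ Set.Icc m M := by
    intro x hx
    obtain _ | _ := subsingleton_or_nontrivial (E →L[ℂ] E)
    · simp [spectrum.of_subsingleton] at hx
    · have hT : IsSelfAdjoint T := .of_nonneg h0
      rw [← Algebra.algebraMap_eq_smul_one] at h1 h2
      exact ⟨(algebraMap_le_iff_le_spectrum hT).1 h1 x hx,
        (le_algebraMap_iff_spectrum_le hT).1 h2 x hx⟩
  refine ⟨h0, ?_, hs⟩
  exact (spectrum.zero_notMem_iff ℝ).1 fun h => hm.not_ge (hs h).1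

/-- A scalar inequality on `[m, M]` between `x ^ r`, `x`, `x⁻¹` and constants yields the
corresponding operator inequality. -/
theorem combination_nonneg {T : E →L[ℂ] E} {m M : ℝ} (hm : 0 < m)
    (h1 : m • (1 : E →L[ℂ] E) ≤ T) (h2 : T ≤ M • (1 : E →L[ℂ] E)) {r a b c d : ℝ}
    (h : ∀ x, m ≤ x → x ≤ M → 0 ≤ a * x ^ r + b * x + c * x⁻¹ + d) :
    0 ≤ a • CFC.rpow T r + b • T + c • Ring.inverse T + d • (1 : E →L[ℂ] E) := by
  obtain ⟨h0, hu, hs⟩ := spectrum_subset_Icc_of_smul_one_le hm h1 h2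
  have hne : ∀ x ∈ spectrum ℝ T, x ≠ 0 := fun x hx => (hm.trans_le (hs hx).1).ne'
  have c1 : ContinuousOn (fun x : ℝ => x ^ r) (spectrum ℝ T) :=
    ContinuousOn.rpow_const continuousOn_id fun x hx => Or.inl (hne x hx)
  have c2 : ContinuousOn (fun x : ℝ => x⁻¹) (spectrum ℝ T) := continuousOn_inv₀.mono hne
  have c3 : ContinuousOn (fun x : ℝ => a * x ^ r) (spectrum ℝ T) := c1.const_mul a
  have c4 : ContinuousOn (fun x : ℝ => b * x) (spectrum ℝ T) := continuousOn_id.const_mul b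
  have c5 : ContinuousOn (fun x : ℝ => c * x⁻¹) (spectrum ℝ T) := c2.const_mul c
  have hT : IsSelfAdjoint T := .of_nonneg h0
  have key : a • CFC.rpow T r + b • T + c • Ring.inverse T + d • (1 : E →L[ℂ] E) =
      cfc (fun x : ℝ => a * x ^ r + b * x + c * x⁻¹ + d) T := by
    rw [cfc_add_const d _ T ((c3.fun_add c4).fun_add c5) hT, cfc_add T _ _ (c3.fun_add c4) c5,
      cfc_add T _ _ c3 c4, cfc_const_mul a _ T c1, cfc_const_mul b (fun x => x) T continuousOn_id,
      cfc_const_mul c _ T c2, cfc_id' ℝ T hT, cfc_ringInverse_id T hu hT,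
      Algebra.algebraMap_eq_smul_one, ← CFC.rpow_eq_cfc_real (a := T) h0]
    rfl
  rw [key]
  exact cfc_nonneg fun x hx => h x (hs hx).1 (hs hx).2

theorem ringInverse_bounds {T : E →L[ℂ] E} {m M : ℝ} (hm : 0 < m)
    (h1 : m • (1 : E →L[ℂ] E) ≤ T) (h2 : T ≤ M • (1 : E →L[ℂ] E)) :
    M⁻¹ • (1 : E →L[ℂ] E) ≤ Ring.inverse T ∧ Ring.inverse T ≤ m⁻¹ • (1 : E →L[ℂ] E) := by
  have l := combination_nonneg (r := 1) (a := 0) (b := 0) (c := 1) (d := -M⁻¹) hm h1 h2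
    fun x hx hx' => by
      have := inv_anti₀ (hm.trans_le hx) hx'
      linarith
  have u := combination_nonneg (r := 1) (a := 0) (b := 0) (c := -1) (d := m⁻¹) hm h1 h2
    fun x hx hx' => by
      have := inv_anti₀ hm hx
      linarith
  constructor
  · rw [← sub_nonneg]
    convert l using 1
    module
  · rw [← sub_nonneg]
    convert u using 1
    module

/-- Weighted averages of operators stay within common scalar bounds. -/
theorem weighted_sum_bounds {n : ℕ} {ω : Fin n → ℝ} (hω0 : ∀ j, 0 ≤ ω j) (hω1 : ∑ j, ω j = 1)
    {B : Fin n → E →L[ℂ] E} {m M : ℝ}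
    (h1 : ∀ j, m • (1 : E →L[ℂ] E) ≤ B j) (h2 : ∀ j, B j ≤ M • (1 : E →L[ℂ] E)) :
    m • (1 : E →L[ℂ] E) ≤ ∑ j, ω j • B j ∧ ∑ j, ω j • B j ≤ M • (1 : E →L[ℂ] E) := by
  have hc : ∀ c : ℝ, c • (1 : E →L[ℂ] E) = ∑ j, ω j • c • (1 : E →L[ℂ] E) := fun c => by
    rw [← Finset.sum_smul, hω1, one_smul]
  constructor
  · rw [hc m]
    exact Finset.sum_le_sum fun j _ => smul_le_smul_of_nonneg_left (h1 j) (hω0 j)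
  · rw [hc M]
    exact Finset.sum_le_sum fun j _ => smul_le_smul_of_nonneg_left (h2 j) (hω0 j)

/-- Furuta's Kantorovich-type inequality: `S ≤ T` implies `S ^ r ≤ K(M / m, r) T ^ r`. -/
theorem rpow_le_Kconst_smul_rpow {S T : E →L[ℂ] E} {m M r : ℝ} (hm : 0 < m) (hmM : m < M)
    (hr : 1 ≤ r) (hmS : m • (1 : E →L[ℂ] E) ≤ S) (hST : S ≤ T)
    (hTM : T ≤ M • (1 : E →L[ℂ] E)) :
    CFC.rpow S r ≤ Kconst (M / m) r • CFC.rpow T r := by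
  set a := (M ^ r - m ^ r) / (M - m) with ha
  have ha0 : 0 ≤ a := div_nonneg
    (sub_nonneg.2 (Real.rpow_le_rpow hm.le hmM.le (by linarith))) (sub_nonneg.2 hmM.le)
  have hS := combination_nonneg (r := r) (a := -1) (b := a) (c := 0) (d := m ^ r - a * m)
    hm hmS (hST.trans hTM) fun x hx hx' => by
      have := rpow_le_chord (Or.inr hr) hm hmM hx hx'
      rw [← ha] at this
      linarith
  have hT := combination_nonneg (r := r) (a := Kconst (M / m) r) (b := -a) (c := 0)
    (d := -(m ^ r - a * m)) hm (hmS.trans hST) hTM fun x hx hx' => by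
      have := chord_le_Kconst_mul_rpow hm hmM hr (hm.trans_le hx)
      rw [← ha] at this
      linarith
  have hab : 0 ≤ a • (T - S) := smul_nonneg ha0 (sub_nonneg.2 hST)
  rw [← sub_nonneg]
  convert add_nonneg (add_nonneg hS hT) hab using 1
  module

/-- The `r`-th powers of `A₁, …, Aₙ` average to at most `α (∑ ωⱼ Aⱼ⁻¹)⁻ʳ + γ`. -/
theorem weighted_sum_rpow_le {n : ℕ} {ω : Fin n → ℝ} (hω0 : ∀ j, 0 ≤ ω j) (hω1 : ∑ j, ω j = 1)
    {A : Fin n → E →L[ℂ] E} {m M r α : ℝ} (hm : 0 < m) (hmM : m < M) (hr : 0 < r) (hα : 0 < α)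
    (hA1 : ∀ j, m • (1 : E →L[ℂ] E) ≤ A j) (hA2 : ∀ j, A j ≤ M • (1 : E →L[ℂ] E)) :
    m • (1 : E →L[ℂ] E) ≤ Ring.inverse (∑ j, ω j • Ring.inverse (A j)) ∧
    ∑ j, ω j • CFC.rpow (A j) r ≤
      α • CFC.rpow (Ring.inverse (∑ j, ω j • Ring.inverse (A j))) r +
        gammaConst (1 / M) (1 / m) (-r) α • (1 : E →L[ℂ] E) := by
  have hM : 0 < M := hm.trans hmM
  set S := ∑ j, ω j • Ring.inverse (A j) with hS
  obtain ⟨hS1, hS2⟩ := weighted_sum_bounds hω0 hω1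
    (fun j => (ringInverse_bounds hm (hA1 j) (hA2 j)).1)
    (fun j => (ringInverse_bounds hm (hA1 j) (hA2 j)).2)
  rw [← hS] at hS1 hS2
  have hSu : IsUnit S := (spectrum_subset_Icc_of_smul_one_le (inv_pos.2 hM) hS1 hS2).2.1
  obtain ⟨hI1, hI2⟩ := ringInverse_bounds (inv_pos.2 hM) hS1 hS2
  rw [inv_inv] at hI1 hI2
  refine ⟨hI1, ?_⟩
  have hlt : 1 / M < 1 / m := one_div_lt_one_div_of_lt hm hmM
  set a := ((1 / m) ^ (-r) - (1 / M) ^ (-r)) / (1 / m - 1 / M) with ha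
  set b := (1 / M) ^ (-r) - a * (1 / M) with hb
  have hinv : ∀ x, m ≤ x → x ≤ M → 1 / M ≤ x⁻¹ ∧ x⁻¹ ≤ 1 / m ∧ (x⁻¹) ^ (-r) = x ^ r := by
    intro x hx hx'
    have hx0 := hm.trans_le hx
    refine ⟨?_, ?_, ?_⟩
    · rw [one_div]
      exact inv_anti₀ hx0 hx'
    · rw [one_div]
      exact inv_anti₀ hm hx
    · rw [Real.rpow_neg (inv_nonneg.2 hx0.le), Real.inv_rpow hx0.le, inv_inv]
  have hj : ∀ j, CFC.rpow (A j) r ≤ a • Ring.inverse (A j) + b • (1 : E →L[ℂ] E) := by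
    intro j
    have := combination_nonneg (r := r) (a := -1) (b := 0) (c := a) (d := b) hm (hA1 j) (hA2 j)
      fun x hx hx' => by
        obtain ⟨e1, e2, e3⟩ := hinv x hx hx'
        have := rpow_le_chord (p := -r) (Or.inl (by linarith)) (one_div_pos.2 hM) hlt e1 e2
        rw [← ha, e3] at this
        linarith
    rw [← sub_nonneg]
    convert this using 1
    module
  have hsum : ∑ j, ω j • CFC.rpow (A j) r ≤ a • S + b • (1 : E →L[ℂ] E) := by
    calc ∑ j, ω j • CFC.rpow (A j) r
        ≤ ∑ j, ω j • (a • Ring.inverse (A j) + b • (1 : E →L[ℂ] E)) :=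
          Finset.sum_le_sum fun j _ => smul_le_smul_of_nonneg_left (hj j) (hω0 j)
      _ = a • S + b • (1 : E →L[ℂ] E) := by
          simp_rw [smul_add, Finset.sum_add_distrib, ← Finset.sum_smul, hω1, one_smul, hS,
            Finset.smul_sum]
          congr 1
          exact Finset.sum_congr rfl fun j _ => smul_comm _ _ _
  have hI := combination_nonneg (r := r) (a := α) (b := 0) (c := -a)
    (d := gammaConst (1 / M) (1 / m) (-r) α - b) hm hI1 hI2 fun x hx hx' => by
      obtain ⟨e1, e2, e3⟩ := hinv x hx hx'
      have := chord_le_mul_rpow_add_gammaConst (p := -r) (one_div_pos.2 hM) hlt (by linarith) hα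
        e1 e2
      rw [← ha, e3] at this
      linarith
  rw [Ring.inverse_inverse hSu] at hI
  refine hsum.trans ?_
  rw [← sub_nonneg]
  convert hI using 1
  module

end OperatorInequalities

theorem stmt10
    {H K : Type*}
    [NormedAddCommGroup H] [InnerProductSpace ℂ H] [CompleteSpace H]
    [NormedAddCommGroup K] [InnerProductSpace ℂ K] [CompleteSpace K]
    {n : ℕ} (ω : Fin n → ℝ) (hω0 : ∀ j, 0 ≤ ω j) (hω1 : ∑ j, ω j = 1)
    (m M : ℝ) (hm : 0 < m) (hmM : m < M)
    (A : Fin n → (H →L[ℂ] H))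
    (hA0 : ∀ j, 0 ≤ A j) (hAu : ∀ j, IsUnit (A j))
    (hA1 : ∀ j, m • (1 : H →L[ℂ] H) ≤ A j)
    (hA2 : ∀ j, A j ≤ M • (1 : H →L[ℂ] H))
    (Φ : (H →L[ℂ] H) →ₗ[ℂ] (K →L[ℂ] K))
    (hΦ1 : Φ 1 = 1) (hΦpos : ∀ T : H →L[ℂ] H, 0 ≤ T → 0 ≤ Φ T)
    (F : (Fin n → (H →L[ℂ] H)) → (H →L[ℂ] H))
    (G : (Fin n → (K →L[ℂ] K)) → (K →L[ℂ] K))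
    (hF : IsAHSandwich ω F) (hG : IsAHSandwich ω G)
    (r : ℝ) (hr : 1 ≤ r)
    :
    G (fun j => Φ (CFC.rpow (A j) r)) - Φ (CFC.rpow (F A) r) ≤
      gammaConst (1 / M) (1 / m) (-r) ((Kconst (M / m) r)⁻¹) • (1 : K →L[ℂ] K) := by
  have hK : 0 < Kconst (M / m) r := Kconst_pos ((one_lt_div hm).2 hmM) hr
  have hr0 : 0 < r := by linarith
  obtain ⟨hmI, hle⟩ := weighted_sum_rpow_le hω0 hω1 hm hmM hr0 (inv_pos.2 hK) hA1 hA2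
  obtain ⟨-, hF1, hF2⟩ := hF A hA0 hAu
  have hFM : F A ≤ M • (1 : H →L[ℂ] H) :=
    hF2.trans (weighted_sum_bounds hω0 hω1 hA1 hA2).2
  have hpow : ∑ j, ω j • CFC.rpow (A j) r ≤ CFC.rpow (F A) r +
      gammaConst (1 / M) (1 / m) (-r) ((Kconst (M / m) r)⁻¹) • (1 : H →L[ℂ] H) := by
    refine hle.trans (add_le_add_left ?_ _)
    have := smul_le_smul_of_nonneg_left
      (rpow_le_Kconst_smul_rpow hm hmM hr hmI hF1 hFM) (inv_pos.2 hK).le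
    rwa [inv_smul_smul₀ hK.ne'] at this
  have hΦsmul : ∀ (c : ℝ) (T : H →L[ℂ] H), Φ (c • T) = c • Φ T :=
    fun c T => Φ.map_smul_of_tower c T
  have hΦmono : ∀ S T : H →L[ℂ] H, S ≤ T → Φ S ≤ Φ T := fun S T hST => by
    rw [← sub_nonneg, ← map_sub]
    exact hΦpos _ (sub_nonneg.2 hST)
  have hlow : ∀ j, m ^ r • (1 : K →L[ℂ] K) ≤ Φ (CFC.rpow (A j) r) := by
    intro j
    have h := combination_nonneg (r := r) (a := 1) (b := 0) (c := 0) (d := -m ^ r) hm (hA1 j)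
      (hA2 j) fun x hx _ => by
        have := Real.rpow_le_rpow hm.le hx hr0.le
        linarith
    rw [← hΦ1, ← hΦsmul]
    refine hΦmono _ _ ?_
    rw [← sub_nonneg]
    convert h using 1
    module
  have hpos : IsStrictlyPositive (m ^ r • (1 : K →L[ℂ] K)) :=
    ⟨smul_nonneg (Real.rpow_nonneg hm.le r) zero_le_one,
      (isUnit_one (M := K →L[ℂ] K)).smul (Units.mk0 _ (Real.rpow_pos_of_pos hm r).ne')⟩
  obtain ⟨-, -, hG2⟩ := hG (fun j => Φ (CFC.rpow (A j) r)) (fun j => (hpos.of_le (hlow j)).nonneg)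
    (fun j => (hpos.of_le (hlow j)).isUnit)
  rw [sub_le_iff_le_add']
  refine hG2.trans ?_
  have := hΦmono _ _ hpow
  rwa [map_sum, map_add, hΦsmul, hΦ1, Finset.sum_congr rfl fun j _ => hΦsmul _ _] at this
end
end

section
/- Let A₁, …, Aₙ be positive invertible operators on H with mI ≤ Aⱼ ≤ MI (j = 1, …, n) for some scalars 0 < m < M, let Φ : B(H) → B(K) be a unital positive linear map, let h = M/m, and let F (on H) and G (on K) each satisfy the arithmetic–harmonic sandwich for the probability vector ω. Then for every r ≥ 1, G(Φ(A₁ʳ), …, Φ(Aₙʳ)) ≤ K(h, −r)·K(h, r)·Φ(F(A₁, …, Aₙ)ʳ). -/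
noncomputable section

lemma one_add_mul_sub_one_le_rpow {p s : ℝ} (hp : p < 0 ∨ 1 ≤ p) (hs : 0 < s) :
    1 + p * (s - 1) ≤ s ^ p := by
  rcases hp with hp | hp
  · have hlog : p * (s - 1) ≤ Real.log s * p := by
      nlinarith [Real.log_le_sub_one_of_pos hs]
    rw [Real.rpow_def_of_pos hs]
    linarith [Real.add_one_le_exp (Real.log s * p)]
  · simpa using one_add_mul_self_le_rpow_one_add (s := s - 1) (by linarith) hp

lemma rpow_add_le_of_convex_weights {p x y u v : ℝ} (hp : p < 0 ∨ 1 ≤ p) (hx : 0 < x) (hy : 0 < y)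
    (hu : 0 ≤ u) (hv : 0 ≤ v) (huv : u + v = 1) :
    (u * x + v * y) ^ p ≤ u * x ^ p + v * y ^ p := by
  set t := u * x + v * y with ht
  have ht0 : 0 < t := by
    rcases hu.eq_or_lt with rfl | hu
    · have : v = 1 := by linarith
      simp [ht, this, hy]
    · exact add_pos_of_pos_of_nonneg (mul_pos hu hx) (mul_nonneg hv hy.le)
  have tangent : ∀ z, 0 < z → t ^ p * (1 + p * (z / t - 1)) ≤ z ^ p := fun z hz => by
    have h := mul_le_mul_of_nonneg_left
      (one_add_mul_sub_one_le_rpow hp (div_pos hz ht0)) (Real.rpow_nonneg ht0.le p)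
    rwa [← Real.mul_rpow ht0.le (div_pos hz ht0).le, mul_div_cancel₀ _ ht0.ne'] at h
  calc t ^ p = t ^ p * ((u + v) + p * ((u * x + v * y) / t - (u + v))) := by
        rw [huv, ← ht, div_self ht0.ne']; ring
    _ = u * (t ^ p * (1 + p * (x / t - 1))) + v * (t ^ p * (1 + p * (y / t - 1))) := by
        ring
    _ ≤ u * x ^ p + v * y ^ p :=
        add_le_add (mul_le_mul_of_nonneg_left (tangent x hx) hu)
          (mul_le_mul_of_nonneg_left (tangent y hy) hv)

lemma Kconst_factors_pos {h p : ℝ} (hh : 1 < h) (hp : p < 0 ∨ 1 < p) :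
    0 < (h ^ p - h) / ((p - 1) * (h - 1)) ∧
      0 < ((p - 1) / p) * ((h ^ p - 1) / (h ^ p - h)) := by
  rcases hp with hp | hp
  · have h1 : h ^ p < 1 := Real.rpow_lt_one_of_one_lt_of_neg hh hp
    exact ⟨div_pos_of_neg_of_neg (by linarith) (by nlinarith),
      mul_pos (div_pos_of_neg_of_neg (by linarith) hp)
        (div_pos_of_neg_of_neg (by linarith) (by linarith))⟩
  · have h1 : h < h ^ p := Real.self_lt_rpow_of_one_lt hh hp
    exact ⟨div_pos (by linarith) (by nlinarith),
      mul_pos (div_pos (by linarith) (by linarith)) (div_pos (by linarith) (by linarith))⟩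

lemma Kconst_nonneg {h p : ℝ} (hh : 1 < h) (hp : p < 0 ∨ 1 ≤ p) : 0 ≤ Kconst h p := by
  unfold Kconst
  split_ifs with hp01
  · exact zero_le_one
  · have hp' : p < 0 ∨ 1 < p := by grind
    obtain ⟨hc, hq⟩ := Kconst_factors_pos hh hp'
    exact mul_nonneg hc.le (Real.rpow_nonneg hq.le _)

lemma chord_le_Kconst_mul_rpow_s11 {h p u : ℝ} (hh : 1 < h) (hp : p < 0 ∨ 1 ≤ p) (hu : 0 < u) :
    ((h ^ p - 1) * u + (h - h ^ p)) / (h - 1) ≤ Kconst h p * u ^ p := by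
  have hh1 : h - 1 ≠ 0 := by linarith
  unfold Kconst
  split_ifs with hp01
  · obtain rfl : p = 1 := by grind
    simp [hh1]
  · have hp' : p < 0 ∨ 1 < p := by grind
    obtain ⟨hc, hq⟩ := Kconst_factors_pos hh hp'
    have hp0 : p ≠ 0 := by grind
    have hp1 : p - 1 ≠ 0 := by grind
    have hhp : h ^ p - h ≠ 0 := fun h0 => by simp [h0] at hc
    rw [mul_assoc, ← Real.mul_rpow hq.le hu.le]
    refine le_trans (le_of_eq ?_)
      (mul_le_mul_of_nonneg_left (one_add_mul_sub_one_le_rpow hp (mul_pos hq hu)) hc.le)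
    field_simp
    ring

/-- The chord of `t ↦ t ^ p` over `[m, M]` dominates `t ^ p` there, and is dominated by
`K(M / m, p) * t ^ p` on the whole positive half-line. -/
lemma exists_affine_rpow_bounds {m M p : ℝ} (hm : 0 < m) (hmM : m < M) (hp : p < 0 ∨ 1 ≤ p) :
    ∃ a b : ℝ, (1 ≤ p → 0 ≤ a) ∧ (∀ t ∈ Set.Icc m M, t ^ p ≤ a * t + b) ∧
      ∀ t, 0 < t → a * t + b ≤ Kconst (M / m) p * t ^ p := by
  have hM : 0 < M := hm.trans hmM
  have hd : 0 < M - m := by linarith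
  refine ⟨(M ^ p - m ^ p) / (M - m), (M * m ^ p - m * M ^ p) / (M - m), fun h1 => ?_,
    fun t ht => ?_, fun t ht => ?_⟩
  · exact div_nonneg
      (sub_nonneg.2 (Real.rpow_le_rpow hm.le hmM.le (zero_le_one.trans h1))) hd.le
  · have h := rpow_add_le_of_convex_weights hp hm hM
      (div_nonneg (sub_nonneg.2 ht.2) hd.le) (div_nonneg (sub_nonneg.2 ht.1) hd.le)
      (by field_simp; ring)
    convert h using 1
    · congr 1
      field_simp
      ring
    · field_simp
      ring
  · obtain ⟨h, rfl⟩ : ∃ h, M = m * h := ⟨M / m, by field_simp⟩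
    obtain ⟨u, rfl⟩ : ∃ u, t = m * u := ⟨t / m, by field_simp⟩
    have hh : 1 < h := by nlinarith
    have hu : 0 < u := pos_of_mul_pos_right ht hm.le
    have hh1 : h - 1 ≠ 0 := by linarith
    have hh1' : m * h - m ≠ 0 := hd.ne'
    rw [mul_div_cancel_left₀ _ hm.ne', Real.mul_rpow hm.le (by linarith),
      Real.mul_rpow hm.le hu.le]
    refine le_trans (le_of_eq ?_) ((mul_le_mul_of_nonneg_left
      (chord_le_Kconst_mul_rpow_s11 hh hp hu) (Real.rpow_nonneg hm.le p)).trans_eq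
        (mul_left_comm _ _ _))
    rw [show m * h - m = m * (h - 1) by ring]
    field_simp

lemma smul_add_smul_one_eq_cfc {E : Type*} [CStarAlgebra E] {T : E} (hT : IsSelfAdjoint T)
    (a b : ℝ) :
    a • T + b • (1 : E) = cfc (fun t : ℝ => a * t + b) T := by
  rw [cfc_add_const b (fun t : ℝ => a * t) T, cfc_const_mul_id a T,
    Algebra.algebraMap_eq_smul_one]

section CStar

variable {E : Type*} [CStarAlgebra E] [PartialOrder E] [StarOrderedRing E]

lemma isStrictlyPositive_of_smul_one_le {c : ℝ} (hc : 0 < c) {T : E} (hT : c • (1 : E) ≤ T) :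
    IsStrictlyPositive T := by
  have h1 : IsStrictlyPositive (c • (1 : E)) :=
    ⟨smul_nonneg hc.le zero_le_one, (Units.mk0 c hc.ne' • (1 : Eˣ)).isUnit⟩
  exact ⟨h1.nonneg.trans hT, CStarAlgebra.isUnit_of_le _ hT h1⟩

lemma spectrum_pos_of_isStrictlyPositive {T : E} (hT : IsStrictlyPositive T) {t : ℝ}
    (ht : t ∈ spectrum ℝ T) : 0 < t :=
  (spectrum_nonneg_of_nonneg hT.nonneg ht).lt_of_ne
    fun h => spectrum.zero_notMem ℝ hT.isUnit (h ▸ ht)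

lemma spectrum_subset_Icc {m M : ℝ} {T : E} (hT : IsSelfAdjoint T) (h1 : m • (1 : E) ≤ T)
    (h2 : T ≤ M • (1 : E)) : spectrum ℝ T ⊆ Set.Icc m M := by
  rw [← Algebra.algebraMap_eq_smul_one] at h1 h2
  exact fun t ht => ⟨(algebraMap_le_iff_le_spectrum hT).1 h1 t ht,
    (le_algebraMap_iff_spectrum_le hT).1 h2 t ht⟩

lemma ringInverse_eq_cfc {T : E} (hT : IsStrictlyPositive T) :
    Ring.inverse T = cfc (fun t : ℝ => t⁻¹) T :=
  (cfc_ringInverse_id (R := ℝ) T hT.isUnit hT.isSelfAdjoint).symm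

lemma continuousOn_rpow_spectrum {T : E} (hT : IsStrictlyPositive T) (p : ℝ) :
    ContinuousOn (fun t : ℝ => t ^ p) (spectrum ℝ T) := fun _ ht =>
  (Real.continuousAt_rpow_const _ _
    (.inl (spectrum_pos_of_isStrictlyPositive hT ht).ne')).continuousWithinAt

lemma continuousOn_inv_spectrum {T : E} (hT : IsStrictlyPositive T) :
    ContinuousOn (fun t : ℝ => t⁻¹) (spectrum ℝ T) := fun _ ht =>
  (continuousAt_inv₀ (spectrum_pos_of_isStrictlyPositive hT ht).ne').continuousWithinAt

lemma rpow_eq_cfc {T : E} (hT : IsStrictlyPositive T) (p : ℝ) :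
    CFC.rpow T p = cfc (fun t : ℝ => t ^ p) T :=
  CFC.rpow_eq_cfc_real hT.nonneg

lemma smul_inverse_add_smul_one_eq_cfc {T : E} (hT : IsStrictlyPositive T) (a b : ℝ) :
    a • Ring.inverse T + b • (1 : E) = cfc (fun t : ℝ => a * t⁻¹ + b) T := by
  have hc := continuousOn_inv_spectrum hT
  have := hT.isSelfAdjoint
  rw [cfc_add_const b (fun t : ℝ => a * t⁻¹) T (continuousOn_const.mul hc), cfc_const_mul a _ T hc,
    Algebra.algebraMap_eq_smul_one, ringInverse_eq_cfc hT]

lemma smul_rpow_eq_cfc {T : E} (hT : IsStrictlyPositive T) (k p : ℝ) :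
    k • CFC.rpow T p = cfc (fun t : ℝ => k * t ^ p) T := by
  rw [cfc_const_mul k _ T (continuousOn_rpow_spectrum hT p), rpow_eq_cfc hT]

lemma smul_add_smul_one_le_smul_rpow {T : E} (hT : IsStrictlyPositive T) {a b k p : ℝ}
    (h : ∀ t, 0 < t → a * t + b ≤ k * t ^ p) :
    a • T + b • (1 : E) ≤ k • CFC.rpow T p := by
  rw [smul_add_smul_one_eq_cfc hT.isSelfAdjoint, smul_rpow_eq_cfc hT]
  exact cfc_mono (fun t ht => h t (spectrum_pos_of_isStrictlyPositive hT ht))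
    (by fun_prop) (continuousOn_const.mul (continuousOn_rpow_spectrum hT p))

lemma smul_add_smul_one_le_smul_rpow_inverse {T : E} (hT : IsStrictlyPositive T) {a b k r : ℝ}
    (h : ∀ t, 0 < t → a * t + b ≤ k * t ^ (-r)) :
    a • T + b • (1 : E) ≤ k • CFC.rpow (Ring.inverse T) r := by
  refine (smul_add_smul_one_le_smul_rpow hT h).trans_eq ?_
  obtain ⟨T', rfl⟩ := hT.isUnit
  rw [Ring.inverse_unit]
  exact congrArg (k • ·) (CFC.rpow_neg T' r hT.nonneg)

lemma rpow_le_smul_add_smul_one {T : E} (hT : IsStrictlyPositive T) {m M a b p : ℝ}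
    (hs : spectrum ℝ T ⊆ Set.Icc m M) (h : ∀ t ∈ Set.Icc m M, t ^ p ≤ a * t + b) :
    CFC.rpow T p ≤ a • T + b • (1 : E) := by
  rw [smul_add_smul_one_eq_cfc hT.isSelfAdjoint, rpow_eq_cfc hT]
  exact cfc_mono (fun t ht => h t (hs ht)) (continuousOn_rpow_spectrum hT p) (by fun_prop)

lemma rpow_le_smul_inverse_add_smul_one {T : E} (hT : IsStrictlyPositive T) {m M a b r : ℝ}
    (hm : 0 < m) (hs : spectrum ℝ T ⊆ Set.Icc m M)
    (h : ∀ t ∈ Set.Icc M⁻¹ m⁻¹, t ^ (-r) ≤ a * t + b) :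
    CFC.rpow T r ≤ a • Ring.inverse T + b • (1 : E) := by
  rw [smul_inverse_add_smul_one_eq_cfc hT, rpow_eq_cfc hT]
  refine cfc_mono (fun t ht => ?_) (continuousOn_rpow_spectrum hT r)
    ((continuousOn_const.mul (continuousOn_inv_spectrum hT)).add continuousOn_const)
  obtain ⟨h1, h2⟩ := hs ht
  have ht0 : 0 < t := hm.trans_le h1
  simpa [Real.rpow_neg_eq_inv_rpow] using
    h t⁻¹ ⟨inv_anti₀ ht0 h2, inv_anti₀ hm h1⟩

lemma inverse_mem_bounds {T : E} (hT : IsStrictlyPositive T) {m M : ℝ} (hm : 0 < m)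
    (hs : spectrum ℝ T ⊆ Set.Icc m M) :
    M⁻¹ • (1 : E) ≤ Ring.inverse T ∧ Ring.inverse T ≤ m⁻¹ • (1 : E) := by
  have hsa := hT.isSelfAdjoint
  rw [← Algebra.algebraMap_eq_smul_one, ← Algebra.algebraMap_eq_smul_one, ringInverse_eq_cfc hT]
  exact ⟨algebraMap_le_cfc _ _ _ (fun t ht => inv_anti₀ (hm.trans_le (hs ht).1) (hs ht).2)
      (continuousOn_inv_spectrum hT),
    cfc_le_algebraMap _ _ _ (fun t ht => inv_anti₀ hm (hs ht).1) (continuousOn_inv_spectrum hT)⟩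

lemma smul_one_le_rpow {T : E} (hT : IsStrictlyPositive T) {m M r : ℝ} (hm : 0 < m) (hr : 0 ≤ r)
    (hs : spectrum ℝ T ⊆ Set.Icc m M) : m ^ r • (1 : E) ≤ CFC.rpow T r := by
  have hsa := hT.isSelfAdjoint
  rw [← Algebra.algebraMap_eq_smul_one, rpow_eq_cfc hT]
  exact algebraMap_le_cfc _ _ _ (fun t ht => Real.rpow_le_rpow hm.le (hs ht).1 hr)
    (continuousOn_rpow_spectrum hT r)

end CStar

theorem stmt11
    {H K : Type*}
    [NormedAddCommGroup H] [InnerProductSpace ℂ H] [CompleteSpace H]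
    [NormedAddCommGroup K] [InnerProductSpace ℂ K] [CompleteSpace K]
    {n : ℕ} (ω : Fin n → ℝ) (hω0 : ∀ j, 0 ≤ ω j) (hω1 : ∑ j, ω j = 1)
    (m M : ℝ) (hm : 0 < m) (hmM : m < M)
    (A : Fin n → (H →L[ℂ] H))
    (hA0 : ∀ j, 0 ≤ A j) (hAu : ∀ j, IsUnit (A j))
    (hA1 : ∀ j, m • (1 : H →L[ℂ] H) ≤ A j)
    (hA2 : ∀ j, A j ≤ M • (1 : H →L[ℂ] H))
    (Φ : (H →L[ℂ] H) →ₗ[ℂ] (K →L[ℂ] K))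
    (hΦ1 : Φ 1 = 1) (hΦpos : ∀ T : H →L[ℂ] H, 0 ≤ T → 0 ≤ Φ T)
    (F : (Fin n → (H →L[ℂ] H)) → (H →L[ℂ] H))
    (G : (Fin n → (K →L[ℂ] K)) → (K →L[ℂ] K))
    (hF : IsAHSandwich ω F) (hG : IsAHSandwich ω G)
    (r : ℝ) (hr : 1 ≤ r)
    :
    G (fun j => Φ (CFC.rpow (A j) r)) ≤
      (Kconst (M / m) (-r) * Kconst (M / m) r) • Φ (CFC.rpow (F A) r) := by
  have hM : 0 < M := hm.trans hmM
  have hA : ∀ j, IsStrictlyPositive (A j) := fun j => ⟨hA0 j, hAu j⟩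
  have hAs : ∀ j, spectrum ℝ (A j) ⊆ Set.Icc m M := fun j =>
    spectrum_subset_Icc (hA j).isSelfAdjoint (hA1 j) (hA2 j)
  have hΦmono : ∀ S T : H →L[ℂ] H, S ≤ T → Φ S ≤ Φ T := fun S T h => by
    simpa using hΦpos _ (sub_nonneg.2 h)
  have hΦsmul : ∀ (c : ℝ) (T : H →L[ℂ] H), Φ (c • T) = c • Φ T := fun c T =>
    LinearMap.map_smul_of_tower Φ c T
  have hΦA : ∀ j, IsStrictlyPositive (Φ (CFC.rpow (A j) r)) := fun j =>
    isStrictlyPositive_of_smul_one_le (Real.rpow_pos_of_pos hm r) (by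
      simpa only [hΦsmul, hΦ1] using
        hΦmono _ _ (smul_one_le_rpow (hA j) hm (zero_le_one.trans hr) (hAs j)))
  obtain ⟨⟨hF0, hFu⟩, hFlow, -⟩ := hF A hA0 hAu
  obtain ⟨-, -, hGup⟩ := hG _ (fun j => (hΦA j).nonneg) (fun j => (hΦA j).isUnit)
  set S := ∑ j, ω j • Ring.inverse (A j) with hS
  have hsum : ∀ c : ℝ, ∑ j, ω j • (c • (1 : H →L[ℂ] H)) = c • 1 := fun c => by
    rw [← Finset.sum_smul, hω1, one_smul]
  have hS1 : M⁻¹ • (1 : H →L[ℂ] H) ≤ S := by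
    rw [← hsum]
    exact Finset.sum_le_sum fun j _ =>
      smul_le_smul_of_nonneg_left (inverse_mem_bounds (hA j) hm (hAs j)).1 (hω0 j)
  have hS2 : S ≤ m⁻¹ • (1 : H →L[ℂ] H) := by
    rw [← hsum]
    exact Finset.sum_le_sum fun j _ =>
      smul_le_smul_of_nonneg_left (inverse_mem_bounds (hA j) hm (hAs j)).2 (hω0 j)
  have hSpos : IsStrictlyPositive S := isStrictlyPositive_of_smul_one_le (inv_pos.2 hM) hS1
  obtain ⟨hI1, hI2⟩ := inverse_mem_bounds hSpos (inv_pos.2 hM)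
    (spectrum_subset_Icc hSpos.isSelfAdjoint hS1 hS2)
  rw [inv_inv] at hI1 hI2
  have hIpos := isStrictlyPositive_of_smul_one_le hm hI1
  have hreverse : ∑ j, ω j • CFC.rpow (A j) r ≤
      Kconst (M / m) (-r) • CFC.rpow (Ring.inverse S) r := by
    obtain ⟨a, b, -, hab, hK⟩ := exists_affine_rpow_bounds (inv_pos.2 hM)
      (inv_strictAnti₀ hm hmM) (.inl (by linarith : -r < 0))
    rw [inv_div_inv] at hK
    refine le_trans ?_ (smul_add_smul_one_le_smul_rpow_inverse hSpos hK)
    rw [← hsum b, hS, Finset.smul_sum, ← Finset.sum_add_distrib]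
    refine Finset.sum_le_sum fun j _ => ?_
    rw [smul_comm a, ← smul_add]
    exact smul_le_smul_of_nonneg_left
      (rpow_le_smul_inverse_add_smul_one (hA j) hm (hAs j) hab) (hω0 j)
  have hpower : CFC.rpow (Ring.inverse S) r ≤ Kconst (M / m) r • CFC.rpow (F A) r := by
    obtain ⟨a, b, ha, hab, hK⟩ := exists_affine_rpow_bounds hm hmM (.inr hr)
    refine (rpow_le_smul_add_smul_one hIpos
      (spectrum_subset_Icc hIpos.isSelfAdjoint hI1 hI2) hab).trans (le_trans ?_
        (smul_add_smul_one_le_smul_rpow ⟨hF0, hFu⟩ hK))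
    gcongr
    exact ha hr
  refine hGup.trans ?_
  simp_rw [← hΦsmul, ← map_sum]
  refine hΦmono _ _ (hreverse.trans ?_)
  rw [mul_smul]
  exact smul_le_smul_of_nonneg_left hpower
    (Kconst_nonneg ((one_lt_div hm).2 hmM) (.inl (by linarith)))
end
end
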